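/- Obstruction to C²-smooth invariant manifolds in Sell's example: there do not exist β > 0 and a function m : (−β,β) → ℝ such that m is differentiable on (−β,β), m' is differentiable at 0, m(0) = 0, and m(p e^{−t}) = e^{−2t} ( m(p) + t p² ) for all t ≥ 0 and all p with |p| < β. -/

import Mathlib

open Real

/-- Differentiating the invariance equation in `p`. -/
theorem deriv_of_graph_invariant {β : ℝ} {m : ℝ → ℝ}
    (hd : ∀ p ∈ Set.Ioo (-β) β, DifferentiableAt ℝ m p)
    (hm : ∀ t : ℝ, 0 ≤ t → ∀ p : ℝ, |p| < β →
      m (p * exp (-t)) = exp (-(2 * t)) * (m p + t * p ^ 2))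
    {t p : ℝ} (ht : 0 ≤ t) (hp : |p| < β) :
    deriv m (p * exp (-t)) = exp (-t) * (deriv m p + 2 * t * p) := by
  have he : exp (-t) ≤ 1 := exp_le_one_iff.2 (by linarith)
  have hpt : |p * exp (-t)| < β := by
    rw [abs_mul, abs_of_pos (exp_pos _)]
    exact (mul_le_of_le_one_right (abs_nonneg p) he).trans_lt hp
  have hl : HasDerivAt (fun q => m (q * exp (-t))) (deriv m (p * exp (-t)) * exp (-t)) p := by
    have h := (hd _ (abs_lt.1 hpt)).hasDerivAt
    have hq : HasDerivAt (fun q : ℝ => q * exp (-t)) (exp (-t)) p := by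
      simpa using (hasDerivAt_id p).mul_const (exp (-t))
    exact h.comp p hq
  have hr : HasDerivAt (fun q => exp (-(2 * t)) * (m q + t * q ^ 2))
      (exp (-(2 * t)) * (deriv m p + t * (2 * p))) p := by
    have hsq : HasDerivAt (fun q : ℝ => q ^ 2) (2 * p) p := by
      simpa using hasDerivAt_pow 2 p
    exact (((hd p (abs_lt.1 hp)).hasDerivAt).add (hsq.const_mul t)).const_mul _
  have heq : (fun q => m (q * exp (-t))) =ᶠ[nhds p]
      fun q => exp (-(2 * t)) * (m q + t * q ^ 2) := by
    filter_upwards [continuous_abs.continuousAt.eventually_lt continuousAt_const hp] with q hq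
    exact hm t ht q hq
  have h := hl.unique (hr.congr_of_eventuallyEq heq)
  have h2 : exp (-(2 * t)) = exp (-t) * exp (-t) := by
    rw [← exp_add]; ring_nf
  rw [h2] at h
  exact mul_right_cancel₀ (exp_pos (-t)).ne' (by linear_combination h)

/-- **Obstruction to `C²`-smooth invariant manifolds in Sell's example (Example 2.13).**
There is no `β > 0` and no function `m` which is differentiable on `(−β,β)`, whose
derivative is differentiable at `0`, with `m 0 = 0`, and whose graph is invariant under the
flow of the resonant two-mode system `u₁' = −u₁`, `u₂' = −2u₂ + u₁²`, i.e. satisfying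
`m(p e^{−t}) = e^{−2t}(m(p) + t p²)` for all `t ≥ 0` and `|p| < β`. -/
theorem stmt_18 :
    ¬ ∃ (β : ℝ) (m : ℝ → ℝ), 0 < β ∧
        (∀ p ∈ Set.Ioo (-β) β, DifferentiableAt ℝ m p) ∧
        DifferentiableAt ℝ (deriv m) 0 ∧
        m 0 = 0 ∧
        ∀ t : ℝ, 0 ≤ t → ∀ p : ℝ, |p| < β →
          m (p * exp (-t)) = exp (-(2 * t)) * (m p + t * p ^ 2) := by
  rintro ⟨β, m, hβ, hd, hdd, -, hm⟩
  have key {t p : ℝ} (ht : 0 ≤ t) (hp : |p| < β) := deriv_of_graph_invariant hd hm ht hp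
  have h0 : deriv m 0 = 0 := by
    have h := key (t := 1) (p := 0) zero_le_one (by simpa using hβ)
    have he : exp (-1) < 1 := exp_lt_one_iff.2 (by norm_num)
    simp only [zero_mul, mul_zero, add_zero] at h
    have h' : (1 - exp (-1)) * deriv m 0 = 0 := by linear_combination h
    exact (mul_eq_zero.1 h').resolve_left (by linarith)
  have hp0 : β / 2 ≠ 0 := by positivity
  have hp : |β / 2| < β := by rw [abs_of_pos (by positivity)]; linarith
  have hexp : Filter.Tendsto (fun t : ℝ => β / 2 * exp (-t)) Filter.atTop
      (nhdsWithin 0 {0}ᶜ) := by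
    refine tendsto_nhdsWithin_iff.2 ⟨?_, .of_forall fun t => mul_ne_zero hp0 (exp_pos _).ne'⟩
    simpa using tendsto_exp_neg_atTop_nhds_zero.const_mul (β / 2)
  have hslope := (hasDerivAt_iff_tendsto_slope.1 hdd.hasDerivAt).comp hexp
  have htop : Filter.Tendsto (fun t : ℝ => deriv m (β / 2) / (β / 2) + 2 * t)
      Filter.atTop Filter.atTop :=
    Filter.tendsto_atTop_add_const_left _ _ (Filter.tendsto_id.const_mul_atTop two_pos)
  refine not_tendsto_nhds_of_tendsto_atTop htop _ (hslope.congr' ?_)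
  filter_upwards [Filter.eventually_ge_atTop 0] with t ht
  have he := (exp_pos (-t)).ne'
  rw [Function.comp_apply, slope_def_field, h0, key ht hp]
  field_simp
  ring
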